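/- arXiv:quant-ph/0506040 — 7 statements merged into one kernel-verified Lean document; each statement's English description precedes it below -/
import Mathlib

section
/- Let 𝒫 be a Boolean algebra and let ℋ be a set of ultrafilters on 𝒫 such that every nonzero element of 𝒫 belongs to some member of ℋ. Let (C_i)_{i∈I} be a family of sets of ultrafilters on 𝒫 and (P_i)_{i∈I} elements of 𝒫 such that for every i ∈ I and every F ∈ ℋ, P_i ∈ F ↔ F ∈ C_i. Suppose Q ∈ 𝒫 satisfies: for every F ∈ ℋ, Q ∈ F ↔ F ∈ ⋃_{i∈I} C_i. Then Q is the least upper bound in 𝒫 of the set {P_i | i ∈ I}. (The boolean value of a union is the join of the boolean values.) -/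
/-- An ultrafilter on a Boolean algebra `α`: a set of nonzero elements, upward closed,
closed under binary meets, containing `P` or `Pᶜ` for every `P`. -/
def IsBAUltrafilter {α : Type*} [BooleanAlgebra α] (F : Set α) : Prop :=
  (∀ P ∈ F, P ≠ ⊥) ∧
  (∀ P ∈ F, ∀ Q : α, P ≤ Q → Q ∈ F) ∧
  (∀ P ∈ F, ∀ Q ∈ F, P ⊓ Q ∈ F) ∧
  (∀ P : α, P ∈ F ∨ Pᶜ ∈ F)

/-- If `ℋ` is a set of ultrafilters meeting every nonzero element, then the order of the algebra
is detected by membership in the elements of `ℋ`. -/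
theorem le_of_forall_mem_imp_mem {α : Type*} [BooleanAlgebra α]
    {ℋ : Set (Set α)} (hult : ∀ F ∈ ℋ, IsBAUltrafilter F)
    (hex : ∀ P : α, P ≠ ⊥ → ∃ F ∈ ℋ, P ∈ F) {A B : α}
    (h : ∀ F ∈ ℋ, A ∈ F → B ∈ F) : A ≤ B := by
  by_contra hAB
  obtain ⟨F, hF, hmem⟩ := hex (A ⊓ Bᶜ) fun h0 =>
    hAB (disjoint_compl_right_iff.mp (disjoint_iff.mpr h0))
  obtain ⟨hne, hup, hinf, -⟩ := hult F hF
  have hB : B ∈ F := h F hF (hup _ hmem _ inf_le_left)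
  have hBc : Bᶜ ∈ F := hup _ hmem _ inf_le_right
  exact hne _ (hinf _ hB _ hBc) inf_compl_eq_bot

/-- The boolean value of a union of posable questions is the join of their boolean values. -/
theorem boolean_value_of_union {α : Type*} [BooleanAlgebra α]
    (ℋ : Set (Set α)) (hult : ∀ F ∈ ℋ, IsBAUltrafilter F)
    (hex : ∀ P : α, P ≠ ⊥ → ∃ F ∈ ℋ, P ∈ F)
    {I : Type*} (C : I → Set (Set α)) (P : I → α)
    (hPC : ∀ i : I, ∀ F ∈ ℋ, (P i ∈ F ↔ F ∈ C i))
    (Q : α) (hQ : ∀ F ∈ ℋ, (Q ∈ F ↔ F ∈ ⋃ i, C i)) :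
    IsLUB (Set.range P) Q := by
  constructor
  · rintro _ ⟨i, rfl⟩
    exact le_of_forall_mem_imp_mem hult hex fun F hF hPi =>
      (hQ F hF).mpr (Set.mem_iUnion.mpr ⟨i, (hPC i F hF).mp hPi⟩)
  · intro R hR
    refine le_of_forall_mem_imp_mem hult hex fun F hF hQF => ?_
    obtain ⟨i, hi⟩ := Set.mem_iUnion.mp ((hQ F hF).mp hQF)
    exact (hult F hF).2.1 _ ((hPC i F hF).mpr hi) _ (hR ⟨i, rfl⟩)
end

section
/- Let 𝒫 be a Boolean algebra and let ℋ be a set of ultrafilters on 𝒫 such that every nonzero element of 𝒫 belongs to some member of ℋ. Let (C_i)_{i∈I} be a family of sets of ultrafilters on 𝒫 and (P_i)_{i∈I} elements of 𝒫 such that for every i ∈ I and every F ∈ ℋ, P_i ∈ F ↔ F ∈ C_i, and suppose some Q ∈ 𝒫 satisfies: for every F ∈ ℋ, Q ∈ F ↔ F ∈ ⋃_{i∈I} C_i. Then every F ∈ ℋ is generic with respect to the set {P_i | i ∈ I}: either P_i ∈ F for some i ∈ I, or there exists R ∈ F with R ⊓ P_i = ⊥ for every i ∈ I. -/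
/-- Every pseudoclassical ultrafilter is generic with respect to the set of boolean
values of a family of posable questions whose union is posable. -/
theorem pseudoclassical_filters_generic {α : Type*} [BooleanAlgebra α]
    (ℋ : Set (Set α)) (hult : ∀ F ∈ ℋ, IsBAUltrafilter F)
    (hex : ∀ P : α, P ≠ ⊥ → ∃ F ∈ ℋ, P ∈ F)
    {I : Type*} (C : I → Set (Set α)) (P : I → α)
    (hPC : ∀ i : I, ∀ F ∈ ℋ, (P i ∈ F ↔ F ∈ C i))
    (Q : α) (hQ : ∀ F ∈ ℋ, (Q ∈ F ↔ F ∈ ⋃ i, C i)) :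
    ∀ F ∈ ℋ, (∃ i : I, P i ∈ F) ∨ ∃ R ∈ F, ∀ i : I, R ⊓ P i = ⊥ := by
  intro F hF
  obtain hQF | hQF := (hult F hF).2.2.2 Q
  · obtain ⟨i, hi⟩ := Set.mem_iUnion.mp ((hQ F hF).mp hQF)
    exact Or.inl ⟨i, (hPC i F hF).mpr hi⟩
  · refine Or.inr ⟨Qᶜ, hQF, fun i => ?_⟩
    by_contra hne
    obtain ⟨G, hG, hmem⟩ := hex _ hne
    obtain ⟨hbot, hup, hinf, -⟩ := hult G hG
    have hPG : P i ∈ G := hup _ hmem _ inf_le_right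
    have hQG : Q ∈ G := (hQ G hG).mpr (Set.mem_iUnion.mpr ⟨i, (hPC i G hG).mp hPG⟩)
    have hQcG : Qᶜ ∈ G := hup _ hmem _ inf_le_left
    exact hbot _ (hinf _ hQG _ hQcG) (inf_compl_self Q)
end

section
/- Let ℙ be any partial order. Then: (a) for every p ∈ ℙ, the set ⌈p⌉^⊥⊥ is a nonempty regular subset of ℙ; (b) the image of the map p ↦ ⌈p⌉^⊥⊥ is dense in the nonempty regular sets, i.e., every nonempty regular X ⊆ ℙ includes ⌈p⌉^⊥⊥ for some p ∈ ℙ; and (c) if ℙ is separative then ⌈p⌉^⊥⊥ = ⌈p⌉ for every p, so p ↦ ⌈p⌉ is an order embedding of ℙ onto a dense subset of the nonempty regular sets. -/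
variable {P : Type*} [PartialOrder P]

/-- `p` and `q` are compatible iff they have a common extension. -/
def Compat (p q : P) : Prop := ∃ r : P, r ≤ p ∧ r ≤ q

/-- The perp of a set: the conditions incompatible with every member of it. -/
def perp (X : Set P) : Set P := {p : P | ∀ q ∈ X, ¬ Compat p q}

/-- A set is regular iff it equals its double perp. -/
def IsRegularSet (X : Set P) : Prop := perp (perp X) = X

theorem Compat.symm {p q : P} (h : Compat p q) : Compat q p :=
  let ⟨r, hp, hq⟩ := h
  ⟨r, hq, hp⟩

theorem Compat.mono_left {p p' q : P} (hp : p ≤ p') (h : Compat p q) : Compat p' q :=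
  let ⟨r, hrp, hrq⟩ := h
  ⟨r, hrp.trans hp, hrq⟩

theorem perp_anti {X Y : Set P} (h : X ⊆ Y) : perp Y ⊆ perp X :=
  fun _ hp _ hq => hp _ (h hq)

theorem subset_perp_perp (X : Set P) : X ⊆ perp (perp X) :=
  fun p hp _ hq h => hq p hp h.symm

theorem isLowerSet_perp (X : Set P) : IsLowerSet (perp X) :=
  fun _ _ hle hp q hq h => hp q hq (h.mono_left hle)

theorem isRegularSet_perp (X : Set P) : IsRegularSet (perp X) :=
  (perp_anti (subset_perp_perp X)).antisymm (subset_perp_perp (perp X))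

theorem IsRegularSet.isLowerSet {X : Set P} (h : IsRegularSet X) : IsLowerSet X :=
  h ▸ isLowerSet_perp (perp X)

theorem IsRegularSet.perp_perp_subset {X Y : Set P} (hY : IsRegularSet Y) (h : X ⊆ Y) :
    perp (perp X) ⊆ Y :=
  (perp_anti (perp_anti h)).trans_eq hY

/-- The map `p ↦ ⌈p⌉^⊥⊥` is a homomorphism of `ℙ` onto a dense subset of the nonzero
part of the regular algebra; if `ℙ` is separative it is the order embedding `p ↦ ⌈p⌉`. -/
theorem cone_dblperp_dense :
    (∀ p : P, IsRegularSet (perp (perp {q : P | q ≤ p})) ∧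
        (perp (perp {q : P | q ≤ p})).Nonempty) ∧
    (∀ X : Set P, IsRegularSet X → X.Nonempty →
        ∃ p : P, perp (perp {q : P | q ≤ p}) ⊆ X) ∧
    ((∀ p : P, IsRegularSet {q : P | q ≤ p}) →
      (∀ p : P, perp (perp {q : P | q ≤ p}) = {q : P | q ≤ p}) ∧
      (∀ p q : P, {r : P | r ≤ p} ⊆ {r : P | r ≤ q} ↔ p ≤ q)) := by
  refine ⟨fun p => ⟨isRegularSet_perp _, p, subset_perp_perp _ le_rfl⟩, ?_, fun hsep =>
    ⟨hsep, fun p q => ⟨fun h => h (le_refl p), fun h r hr => le_trans hr h⟩⟩⟩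
  rintro X hX ⟨p, hp⟩
  exact ⟨p, hX.perp_perp_subset fun q hq => hX.isLowerSet hq hp⟩
end

section
/- Let ℙ be a separative partial order, let A be a complete Boolean algebra, and let ι : ℙ → A be a map such that ι p ≠ ⊥ for every p, p ≤ q ↔ ι p ≤ ι q for all p, q ∈ ℙ, and for every a ∈ A with a ≠ ⊥ there exists p ∈ ℙ with ι p ≤ a (the image of ι is dense in A ∖ {⊥}). Then there is a unique order isomorphism Φ from the regular subsets of ℙ, ordered by inclusion, onto A such that Φ(⌈p⌉) = ι p for every p ∈ ℙ. (The regular algebra is, up to isomorphism, the unique complete Boolean algebra in which ℙ embeds densely.) -/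
variable {P : Type*} [PartialOrder P]

section DenseEmbedding

variable {A : Type*} [CompleteBooleanAlgebra A] {ι : P → A}

theorem compat_iff_not_disjoint (hne : ∀ p : P, ι p ≠ ⊥) (hord : ∀ p q : P, p ≤ q ↔ ι p ≤ ι q)
    (hdense : ∀ a : A, a ≠ ⊥ → ∃ p : P, ι p ≤ a) (p q : P) :
    Compat p q ↔ ¬ Disjoint (ι p) (ι q) := by
  constructor
  · rintro ⟨r, hp, hq⟩ h
    exact hne r (le_bot_iff.1 (h ((hord r p).1 hp) ((hord r q).1 hq)))
  · intro h
    obtain ⟨r, hr⟩ := hdense (ι p ⊓ ι q) (fun h' => h (disjoint_iff.2 h'))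
    exact ⟨r, (hord r p).2 (hr.trans inf_le_left), (hord r q).2 (hr.trans inf_le_right)⟩

theorem perp_eq_setOf_le_compl (hne : ∀ p : P, ι p ≠ ⊥) (hord : ∀ p q : P, p ≤ q ↔ ι p ≤ ι q)
    (hdense : ∀ a : A, a ≠ ⊥ → ∃ p : P, ι p ≤ a) (X : Set P) :
    perp X = {p | ι p ≤ (⨆ q ∈ X, ι q)ᶜ} := by
  ext p
  simp only [perp, Set.mem_ofPred_eq, compat_iff_not_disjoint hne hord hdense, not_not,
    le_compl_iff_disjoint_right, disjoint_iSup_iff]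

omit [PartialOrder P] in
theorem biSup_setOf_le (hne : ∀ p : P, ι p ≠ ⊥)
    (hdense : ∀ a : A, a ≠ ⊥ → ∃ p : P, ι p ≤ a) (a : A) :
    ⨆ p ∈ {p | ι p ≤ a}, ι p = a := by
  refine le_antisymm (iSup₂_le fun p hp => hp) ?_
  by_contra h
  obtain ⟨p, hp⟩ := hdense _ (fun h' => h (sdiff_eq_bot_iff.1 h'))
  have hpa : p ∈ {p | ι p ≤ a} := hp.trans sdiff_le
  exact hne p (le_bot_iff.1 (disjoint_sdiff_self_right (le_iSup₂_of_le p hpa le_rfl) hp))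

theorem isRegularSet_iff_setOf_le_biSup (hne : ∀ p : P, ι p ≠ ⊥)
    (hord : ∀ p q : P, p ≤ q ↔ ι p ≤ ι q) (hdense : ∀ a : A, a ≠ ⊥ → ∃ p : P, ι p ≤ a)
    (X : Set P) : IsRegularSet X ↔ {p | ι p ≤ ⨆ q ∈ X, ι q} = X := by
  rw [IsRegularSet, perp_eq_setOf_le_compl hne hord hdense (perp X),
    perp_eq_setOf_le_compl hne hord hdense X, biSup_setOf_le hne hdense, compl_compl]

/-- A dense embedding into a complete Boolean algebra identifies a regular set with the supremum
of its image. -/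
def regularSetOrderIso (hne : ∀ p : P, ι p ≠ ⊥) (hord : ∀ p q : P, p ≤ q ↔ ι p ≤ ι q)
    (hdense : ∀ a : A, a ≠ ⊥ → ∃ p : P, ι p ≤ a) : {X : Set P // IsRegularSet X} ≃o A where
  toFun X := ⨆ p ∈ X.1, ι p
  invFun a := ⟨{p | ι p ≤ a}, by
    rw [isRegularSet_iff_setOf_le_biSup hne hord hdense, biSup_setOf_le hne hdense]⟩
  left_inv X := Subtype.ext ((isRegularSet_iff_setOf_le_biSup hne hord hdense X.1).1 X.2)
  right_inv a := biSup_setOf_le hne hdense a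
  map_rel_iff' := by
    intro X Y
    refine ⟨fun h p hp => ?_, fun h => biSup_mono h⟩
    rw [← (isRegularSet_iff_setOf_le_biSup hne hord hdense Y.1).1 Y.2]
    exact (le_iSup₂_of_le p hp le_rfl).trans h

end DenseEmbedding

/-- Uniqueness of the regular algebra: if a separative partial order `ℙ` embeds densely
into a complete Boolean algebra `A`, then there is a unique order isomorphism of the
algebra of regular subsets of `ℙ` (ordered by inclusion) onto `A` carrying each cone
`⌈p⌉` to the image of `p`. -/
theorem regular_algebra_unique {A : Type*} [CompleteBooleanAlgebra A]
    (hsep : ∀ p : P, IsRegularSet {q : P | q ≤ p})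
    (ι : P → A)
    (hne : ∀ p : P, ι p ≠ ⊥)
    (hord : ∀ p q : P, p ≤ q ↔ ι p ≤ ι q)
    (hdense : ∀ a : A, a ≠ ⊥ → ∃ p : P, ι p ≤ a) :
    ∃! Φ : {X : Set P // IsRegularSet X} ≃o A,
      ∀ p : P, Φ ⟨{q : P | q ≤ p}, hsep p⟩ = ι p := by
  refine ⟨regularSetOrderIso hne hord hdense, fun p => ?_, fun Ψ hΨ => ?_⟩
  · exact le_antisymm (iSup₂_le fun q hq => (hord q p).1 hq)
      (le_iSup₂_of_le (f := fun q (_ : q ∈ {q : P | q ≤ p}) => ι q) p le_rfl le_rfl)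
  · refine RelIso.ext fun X => ?_
    have hX := (isRegularSet_iff_setOf_le_biSup hne hord hdense X.1).1 X.2
    have hmem : X.1 = {p | ι p ≤ Ψ X} := by
      ext p
      rw [Set.mem_ofPred_eq, ← hΨ p, Ψ.le_iff_le]
      refine ⟨fun hp q hq => ?_, fun h => h (le_refl p)⟩
      rw [← hX] at hp ⊢
      exact ((hord q p).1 hq).trans hp
    change Ψ X = ⨆ p ∈ X.1, ι p
    rw [hmem, biSup_setOf_le hne hdense]
end

section
/- Let ℙ be a partial order, A a complete Boolean algebra, and ι : ℙ → A a map satisfying: (i) for all p, q ∈ ℙ, ι p ⊓ ι q ≤ ⨆ {ι r | r ≤ p and r ≤ q}; and (ii) for every X ⊆ ℙ, (⨆_{p∈X} ι p) ⊔ (⨆_{p∈X^⊥} ι p) = ⊤. Then: (a) for every X ⊆ ℙ, ⨆_{p∈X} ι p = (⨆_{p∈X^⊥} ι p)ᶜ; (b) for every Y ⊆ ℙ, ⨆_{p∈Y^⊥⊥} ι p = ⨆_{p∈Y} ι p; and (c) for every p ∈ ℙ, ⨆_{q ∈ ⌈p⌉^⊥⊥} ι q = ι p. Consequently the map sending a regular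 set X to ⨆_{p∈X} ι p is a complete Boolean homomorphism from the regular algebra of ℙ to A carrying ⌈p⌉^⊥⊥ to ι p. (Universality of the canonical interpretation.) -/
variable {P : Type*} [PartialOrder P]

theorem compat_comm {p q : P} : Compat p q ↔ Compat q p :=
  exists_congr fun _ => and_comm

theorem perp_setOf_le (p : P) : perp {q : P | q ≤ p} = perp {p} := by
  ext s
  constructor
  · rintro h q rfl
    exact h q (le_refl q)
  · rintro h q hq ⟨r, hrs, hrq⟩
    exact h p rfl ⟨r, hrs, hrq.trans hq⟩

theorem disjoint_of_not_compat {A : Type*} [CompleteBooleanAlgebra A] {ι : P → A}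
    (hfil : ∀ p q : P, ι p ⊓ ι q ≤ ⨆ r ∈ {r : P | r ≤ p ∧ r ≤ q}, ι r)
    {p q : P} (h : ¬ Compat p q) : Disjoint (ι p) (ι q) :=
  disjoint_iff_inf_le.2 <| (hfil p q).trans <| iSup₂_le fun r hr => (h ⟨r, hr⟩).elim

theorem isCompl_iSup_perp {A : Type*} [CompleteBooleanAlgebra A] {ι : P → A}
    (hfil : ∀ p q : P, ι p ⊓ ι q ≤ ⨆ r ∈ {r : P | r ≤ p ∧ r ≤ q}, ι r)
    (hgen : ∀ X : Set P, (⨆ p ∈ X, ι p) ⊔ (⨆ p ∈ perp X, ι p) = ⊤) (X : Set P) :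
    IsCompl (⨆ p ∈ X, ι p) (⨆ p ∈ perp X, ι p) := by
  refine ⟨?_, codisjoint_iff.2 (hgen X)⟩
  simp only [iSup_disjoint_iff, disjoint_iSup_iff]
  exact fun p hp q hq => disjoint_of_not_compat hfil (mt compat_comm.1 (hp q hq))

/-- Universality of the canonical interpretation: any `A`-valued interpretation of `ℙ`
for which "`𝗚` is a generic filter" is valid factors through the regular algebra via a
complete Boolean homomorphism `X ↦ ⨆_{p ∈ X} ι p` carrying `⌈p⌉^⊥⊥` to `ι p`. -/
theorem canonical_interpretation_universal {A : Type*} [CompleteBooleanAlgebra A]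
    (ι : P → A)
    (hfil : ∀ p q : P, ι p ⊓ ι q ≤ ⨆ r ∈ {r : P | r ≤ p ∧ r ≤ q}, ι r)
    (hgen : ∀ X : Set P, (⨆ p ∈ X, ι p) ⊔ (⨆ p ∈ perp X, ι p) = ⊤) :
    (∀ X : Set P, (⨆ p ∈ X, ι p) = (⨆ p ∈ perp X, ι p)ᶜ) ∧
    (∀ Y : Set P, (⨆ p ∈ perp (perp Y), ι p) = ⨆ p ∈ Y, ι p) ∧
    (∀ p : P, (⨆ q ∈ perp (perp {q : P | q ≤ p}), ι q) = ι p) ∧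
    (∀ 𝒳 : Set (Set P), (∀ X ∈ 𝒳, IsRegularSet X) →
      (⨆ p ∈ perp (perp (⋃₀ 𝒳)), ι p) = ⨆ X ∈ 𝒳, ⨆ p ∈ X, ι p) ∧
    (∀ X : Set P, IsRegularSet X → (⨆ p ∈ perp X, ι p) = (⨆ p ∈ X, ι p)ᶜ) := by
  have hcompl := isCompl_iSup_perp hfil hgen
  have hperp : ∀ Y : Set P, (⨆ p ∈ perp (perp Y), ι p) = ⨆ p ∈ Y, ι p := fun Y =>
    (hcompl (perp Y)).right_unique (hcompl Y).symm
  refine ⟨fun X => (hcompl X).eq_compl, hperp, fun p => ?_, fun 𝒳 _ => ?_,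
    fun X _ => (hcompl X).symm.eq_compl⟩
  · rw [perp_setOf_le, hperp, iSup_singleton]
  · simp only [hperp, Set.mem_sUnion, iSup_exists, iSup_and]
    rw [iSup_comm]
    exact iSup_congr fun X => iSup_comm
end

section
/- Let A be a complete Boolean algebra, I a type, ι : I → A, and E a Boolean expression over I. If D is an 𝒮(E)-generic prefilter on A, then D ∈ ⟦E⟧^δ if and only if ⟦E⟧^π ∈ D. -/
universe u v

/-- Boolean expressions over an index type `I`, with joins and meets over arbitrary
index types in the universe of `I`. -/
inductive BExpr (I : Type u) : Type (u + 1)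
  | prim : I → BExpr I
  | compl : BExpr I → BExpr I
  | join : (κ : Type u) → (κ → BExpr I) → BExpr I
  | meet : (κ : Type u) → (κ → BExpr I) → BExpr I

namespace BExpr

/-- The set of subexpressions of a boolean expression. -/
def subexp {I : Type u} : BExpr I → Set (BExpr I)
  | .prim i => {BExpr.prim i}
  | .compl E => insert (BExpr.compl E) (subexp E)
  | .join κ f => insert (BExpr.join κ f) (⋃ k : κ, subexp (f k))
  | .meet κ f => insert (BExpr.meet κ f) (⋃ k : κ, subexp (f k))

/-- The value `⟦E⟧^π` of a boolean expression in a complete Boolean algebra under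
the interpretation `ι` of the primitive expressions. -/
def valPi {I : Type u} {A : Type v} [CompleteBooleanAlgebra A] (ι : I → A) : BExpr I → A
  | .prim i => ι i
  | .compl E => (valPi ι E)ᶜ
  | .join _ f => ⨆ k, valPi ι (f k)
  | .meet _ f => ⨅ k, valPi ι (f k)

end BExpr

/-- A prefilter on a Boolean algebra: a set of nonzero elements any two of which have
a common lower bound in the set. -/
def IsBAPrefilter {A : Type v} [CompleteBooleanAlgebra A] (D : Set A) : Prop :=
  (∀ a ∈ D, a ≠ ⊥) ∧ ∀ a ∈ D, ∀ b ∈ D, ∃ c ∈ D, c ≤ a ∧ c ≤ b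

/-- The value `⟦E⟧^δ` of a boolean expression as a set of prefilters. -/
def BExpr.valDelta {I : Type u} {A : Type v} [CompleteBooleanAlgebra A] (ι : I → A) :
    BExpr I → Set (Set A)
  | .prim i => {D | IsBAPrefilter D ∧ ι i ∈ D}
  | .compl E => {D | IsBAPrefilter D} \ BExpr.valDelta ι E
  | .join _ f => ⋃ k, BExpr.valDelta ι (f k)
  | .meet _ f => ⋂ k, BExpr.valDelta ι (f k)

/-- The family `𝒮(E)` of subsets of `A` associated to a boolean expression `E`:
singletons of values of subexpressions, sets of values of disjuncts of join
subexpressions, and sets of complements of values of conjuncts of meet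
subexpressions. -/
def SFam {I : Type u} {A : Type v} [CompleteBooleanAlgebra A] (ι : I → A) (E : BExpr I) :
    Set (Set A) :=
  {S | ∃ E' ∈ E.subexp, S = {BExpr.valPi ι E'}} ∪
  {S | ∃ (κ : Type u) (f : κ → BExpr I), BExpr.join κ f ∈ E.subexp ∧
        S = Set.range fun k => BExpr.valPi ι (f k)} ∪
  {S | ∃ (κ : Type u) (f : κ → BExpr I), BExpr.meet κ f ∈ E.subexp ∧
        S = Set.range fun k => (BExpr.valPi ι (f k))ᶜ}

/-- Genericity of `D` for a single subset `S`. -/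
def MeetsOrAvoids {A : Type v} [CompleteBooleanAlgebra A] (D S : Set A) : Prop :=
  ∃ a ∈ D, a ∈ S ∨ ∀ b ∈ S, a ⊓ b = ⊥

theorem SFam_mono {I : Type u} {A : Type v} [CompleteBooleanAlgebra A] (ι : I → A)
    {E F : BExpr I} (h : E.subexp ⊆ F.subexp) : SFam ι E ⊆ SFam ι F := by
  rintro S ((⟨E', hE', rfl⟩ | ⟨κ, f, hf, rfl⟩) | ⟨κ, f, hf, rfl⟩)
  · exact Or.inl (Or.inl ⟨E', h hE', rfl⟩)
  · exact Or.inl (Or.inr ⟨κ, f, h hf, rfl⟩)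
  · exact Or.inr ⟨κ, f, h hf, rfl⟩

theorem BExpr.self_mem_subexp {I : Type u} (E : BExpr I) : E ∈ E.subexp := by
  cases E <;> simp [BExpr.subexp]

theorem valPi_singleton_mem_SFam {I : Type u} {A : Type v} [CompleteBooleanAlgebra A]
    (ι : I → A) (E : BExpr I) : {BExpr.valPi ι E} ∈ SFam ι E :=
  Or.inl (Or.inl ⟨E, E.self_mem_subexp, rfl⟩)

namespace IsBAPrefilter

variable {A : Type v} [CompleteBooleanAlgebra A] {D : Set A}

theorem inf_ne_bot (hD : IsBAPrefilter D) {a b : A} (ha : a ∈ D) (hb : b ∈ D) :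
    a ⊓ b ≠ ⊥ := by
  obtain ⟨c, hc, hca, hcb⟩ := hD.2 a ha b hb
  exact ne_bot_of_le_ne_bot (hD.1 c hc) (le_inf hca hcb)

theorem mem_of_le (hD : IsBAPrefilter D) {d x : A} (hx : MeetsOrAvoids D {x})
    (hd : d ∈ D) (hdx : d ≤ x) : x ∈ D := by
  obtain ⟨a, ha, rfl | h⟩ := hx
  · exact ha
  · exact absurd (le_bot_iff.1 ((inf_le_inf_left a hdx).trans (h x rfl).le))
      (hD.inf_ne_bot ha hd)

theorem compl_mem_iff (hD : IsBAPrefilter D) {x : A} (hx : MeetsOrAvoids D {x})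
    (hxc : MeetsOrAvoids D {xᶜ}) : xᶜ ∈ D ↔ x ∉ D := by
  refine ⟨fun h h' => hD.inf_ne_bot h' h (inf_compl_self x), fun h => ?_⟩
  obtain ⟨a, ha, rfl | h'⟩ := hx
  · exact absurd ha h
  · exact hD.mem_of_le hxc ha (le_compl_iff_disjoint_right.2 (disjoint_iff.2 (h' x rfl)))

theorem iSup_mem_iff (hD : IsBAPrefilter D) {κ : Type*} {f : κ → A}
    (hsup : MeetsOrAvoids D {⨆ k, f k}) (hf : MeetsOrAvoids D (Set.range f)) :
    ⨆ k, f k ∈ D ↔ ∃ k, f k ∈ D := by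
  refine ⟨fun h => ?_, fun ⟨k, hk⟩ => hD.mem_of_le hsup hk (le_iSup f k)⟩
  obtain ⟨a, ha, ⟨k, rfl⟩ | h'⟩ := hf
  · exact ⟨k, ha⟩
  · refine absurd ?_ (hD.inf_ne_bot ha h)
    rw [inf_iSup_eq, iSup_eq_bot]
    exact fun k => h' _ ⟨k, rfl⟩

theorem iInf_mem_iff (hD : IsBAPrefilter D) {κ : Type*} {f : κ → A}
    (hinf : MeetsOrAvoids D {⨅ k, f k}) (hf : ∀ k, MeetsOrAvoids D {f k})
    (hfc : MeetsOrAvoids D (Set.range fun k => (f k)ᶜ)) :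
    ⨅ k, f k ∈ D ↔ ∀ k, f k ∈ D := by
  refine ⟨fun h k => hD.mem_of_le (hf k) h (iInf_le f k), fun h => ?_⟩
  obtain ⟨a, ha, ⟨k, rfl⟩ | h'⟩ := hfc
  · exact absurd (inf_compl_self (f k)) (hD.inf_ne_bot (h k) ha)
  · refine hD.mem_of_le hinf ha (le_iInf fun k => ?_)
    exact disjoint_compl_right_iff.1 (disjoint_iff.2 (h' _ ⟨k, rfl⟩))

end IsBAPrefilter

/-- For an `𝒮(E)`-generic prefilter `D`, `D ∈ ⟦E⟧^δ` iff `⟦E⟧^π ∈ D`. -/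
theorem valDelta_iff_valPi_mem {I : Type u} {A : Type v} [CompleteBooleanAlgebra A]
    (ι : I → A) (E : BExpr I) (D : Set A) (hD : IsBAPrefilter D)
    (hgen : ∀ S ∈ SFam ι E, ∃ a ∈ D, a ∈ S ∨ ∀ b ∈ S, a ⊓ b = ⊥) :
    D ∈ BExpr.valDelta ι E ↔ BExpr.valPi ι E ∈ D := by
  induction E with
  | prim i => simp [BExpr.valDelta, BExpr.valPi, hD]
  | compl E ih =>
    have hsub : ∀ S ∈ SFam ι E, MeetsOrAvoids D S := fun S hS =>
      hgen S (SFam_mono ι (Set.subset_insert _ _) hS)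
    have hcompl := hD.compl_mem_iff (hsub _ (valPi_singleton_mem_SFam ι E))
      (hgen _ (valPi_singleton_mem_SFam ι E.compl))
    simp [BExpr.valDelta, BExpr.valPi, hD, ih hsub, hcompl]
  | join κ f ih =>
    have hsub : ∀ k, ∀ S ∈ SFam ι (f k), MeetsOrAvoids D S := fun k S hS =>
      hgen S (SFam_mono ι ((Set.subset_iUnion (fun k => (f k).subexp) k).trans
        (Set.subset_insert _ _)) hS)
    have hsup := hD.iSup_mem_iff (hgen _ (valPi_singleton_mem_SFam ι (.join κ f)))
      (hgen _ (Or.inl (Or.inr ⟨κ, f, BExpr.self_mem_subexp _, rfl⟩)))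
    simp only [BExpr.valDelta, BExpr.valPi, Set.mem_iUnion, hsup]
    exact exists_congr fun k => ih k (hsub k)
  | meet κ f ih =>
    have hsub : ∀ k, ∀ S ∈ SFam ι (f k), MeetsOrAvoids D S := fun k S hS =>
      hgen S (SFam_mono ι ((Set.subset_iUnion (fun k => (f k).subexp) k).trans
        (Set.subset_insert _ _)) hS)
    have hinf := hD.iInf_mem_iff (hgen _ (valPi_singleton_mem_SFam ι (.meet κ f)))
      (fun k => hsub k _ (valPi_singleton_mem_SFam ι (f k)))
      (hgen _ (Or.inr ⟨κ, f, BExpr.self_mem_subexp _, rfl⟩))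
    simp only [BExpr.valDelta, BExpr.valPi, Set.mem_iInter, hinf]
    exact forall_congr' fun k => ih k (hsub k)
end

section
/- Let α be a Boolean algebra in which every countable subset has a least upper bound, and suppose α satisfies the countable chain condition: every antichain in α is countable. Then every subset of α has a least upper bound (α is complete). -/
/-- Every subset `D` of a Boolean algebra contains a maximal antichain of nonzero elements. -/
theorem exists_maximal_antichain_subset {α : Type*} [BooleanAlgebra α] (D : Set α) :
    ∃ M : Set α, Maximal (fun A : Set α => A ⊆ D ∧ (∀ a ∈ A, a ≠ ⊥) ∧
      ∀ a ∈ A, ∀ b ∈ A, a ≠ b → a ⊓ b = ⊥) M := by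
  refine zorn_subset _ fun c hc hchain =>
    ⟨⋃₀ c, ⟨Set.sUnion_subset fun A hA => (hc hA).1, ?_, ?_⟩, fun A hA =>
      Set.subset_sUnion_of_mem hA⟩
  · rintro a ⟨A, hA, ha⟩
    exact (hc hA).2.1 a ha
  · rintro a ⟨A, hA, ha⟩ b ⟨B, hB, hb⟩ hab
    rcases hchain.total hA hB with h | h
    · exact (hc hB).2.2 a (h ha) b hb hab
    · exact (hc hA).2.2 a ha b (h hb) hab

/-- A countably complete Boolean algebra satisfying the countable chain condition
(every antichain — a set of nonzero pairwise-incompatible elements — is countable)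
is complete: every subset has a least upper bound. -/
theorem complete_of_countablyComplete_ccc {α : Type*} [BooleanAlgebra α]
    (hcc : ∀ S : Set α, S.Countable → ∃ b : α, IsLUB S b)
    (hccc : ∀ A : Set α, (∀ a ∈ A, a ≠ ⊥) →
      (∀ a ∈ A, ∀ b ∈ A, a ≠ b → a ⊓ b = ⊥) → A.Countable) :
    ∀ S : Set α, ∃ b : α, IsLUB S b := by
  intro S
  obtain ⟨M, hM⟩ := exists_maximal_antichain_subset {d : α | ∃ s ∈ S, d ≤ s}
  obtain ⟨hMS, hne, hdisj⟩ := hM.prop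
  obtain ⟨b, hb⟩ := hcc M (hccc M hne hdisj)
  refine ⟨b, fun s hs => ?_, fun u hu => hb.2 fun d hd => ?_⟩
  · by_contra hsb
    have hd : s ⊓ bᶜ ≠ ⊥ := by
      rwa [← sdiff_eq, Ne, sdiff_eq_bot_iff]
    have hdM : ∀ a ∈ M, a ⊓ (s ⊓ bᶜ) = ⊥ := fun a ha =>
      ((disjoint_compl_right (a := b)).mono (hb.1 ha) inf_le_right).eq_bot
    have hmem : s ⊓ bᶜ ∈ M := by
      refine hM.le_of_ge ⟨?_, ?_, ?_⟩ (Set.subset_insert (s ⊓ bᶜ) M) (Set.mem_insert _ _)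
      · exact Set.insert_subset ⟨s, hs, inf_le_left⟩ hMS
      · rintro a (rfl | ha)
        exacts [hd, hne a ha]
      · rintro a (rfl | ha) c (rfl | hc) hac
        · exact absurd rfl hac
        · rw [inf_comm]
          exact hdM c hc
        · exact hdM a ha
        · exact hdisj a ha c hc hac
    exact hd (by simpa only [inf_idem] using hdM _ hmem)
  · obtain ⟨s, hs, hds⟩ := hMS hd
    exact hds.trans (hu hs)
end
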